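/- arXiv:2303.04531 — 2 statements merged into one kernel-verified Lean document; each statement's English description precedes it below -/
import Mathlib

section
/- For all natural numbers m, n ≥ 1, the number of tuples (a_1,...,a_r) of nonnegative integers with ∑_{i=1}^r a_i = n and ∑_{i=1}^r a_i 2^i = m is at most F(2n-1). -/
namespace PTwo

def N (a : ℕ →₀ ℕ) : ℕ := a.sum (fun _ c => c)
def W (a : ℕ →₀ ℕ) : ℕ := a.sum (fun i c => c * 2 ^ (i + 1))
def S (n m : ℕ) : Set (ℕ →₀ ℕ) := {a | N a = n ∧ W a = m}
noncomputable def mn (a : ℕ →₀ ℕ) : ℕ := sInf {i | a i ≠ 0}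
/-- even multiplicity of the least part -/
def A (n m : ℕ) : Set (ℕ →₀ ℕ) := {a | a ∈ S n m ∧ a ≠ 0 ∧ Even (a (mn a))}
/-- odd multiplicity of the least part -/
def C (n m : ℕ) : Set (ℕ →₀ ℕ) := {a | a ∈ S n m ∧ a ≠ 0 ∧ ¬ Even (a (mn a))}

lemma N_add (a b : ℕ →₀ ℕ) : N (a + b) = N a + N b :=
  Finsupp.sum_add_index' (fun _ => rfl) (fun _ _ _ => rfl)
lemma W_add (a b : ℕ →₀ ℕ) : W (a + b) = W a + W b :=
  Finsupp.sum_add_index' (fun _ => by simp) (fun _ _ _ => by ring)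
lemma N_single (j c : ℕ) : N (Finsupp.single j c) = c := by
  simp [N]
lemma W_single (j c : ℕ) : W (Finsupp.single j c) = c * 2 ^ (j + 1) := by
  simp [W]

lemma mn_ne {a : ℕ →₀ ℕ} (h : a ≠ 0) : a (mn a) ≠ 0 := by
  have : {i | a i ≠ 0}.Nonempty := by
    obtain ⟨i, hi⟩ := Finsupp.ne_iff.1 h
    exact ⟨i, by simpa using hi⟩
  exact Nat.sInf_mem this

lemma lt_mn {a : ℕ →₀ ℕ} {i : ℕ} (h : i < mn a) : a i = 0 := by
  by_contra h'
  exact Nat.notMem_of_lt_sInf h h'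

lemma mn_eq {a : ℕ →₀ ℕ} {j : ℕ} (h : a j ≠ 0) (h' : ∀ i < j, a i = 0) : mn a = j := by
  apply le_antisymm
  · exact Nat.sInf_le h
  · by_contra hlt
    have h0 : a ≠ 0 := by rintro rfl; simp at h
    exact mn_ne h0 (h' _ (by omega))

lemma le_N (a : ℕ →₀ ℕ) (i : ℕ) : a i ≤ N a := by
  have h : Finsupp.single i (a i) ≤ a := by simp
  have := N_add (a - Finsupp.single i (a i)) (Finsupp.single i (a i))
  rw [tsub_add_cancel_of_le h, N_single] at this
  omega

lemma le_W (a : ℕ →₀ ℕ) (i : ℕ) : a i * 2 ^ (i + 1) ≤ W a := by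
  have h : Finsupp.single i (a i) ≤ a := by simp
  have := W_add (a - Finsupp.single i (a i)) (Finsupp.single i (a i))
  rw [tsub_add_cancel_of_le h, W_single] at this
  omega

lemma S_finite (n m : ℕ) : (S n m).Finite := by
  apply (Set.finite_Iic (Finsupp.indicator (Finset.range m) (fun _ _ => n))).subset
  rintro a ⟨h1, h2⟩
  intro i
  by_cases hi : i < m
  · simp only [Finsupp.indicator_apply, Finset.mem_range, hi, dite_true]
    rw [← h1]; exact le_N a i
  · have := le_W a i
    have h3 : i + 1 < 2 ^ (i + 1) := Nat.lt_two_pow_self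
    have h4 : a i = 0 := by
      by_contra h0
      have : 1 * 2 ^ (i + 1) ≤ a i * 2 ^ (i + 1) := Nat.mul_le_mul_right _ (by omega)
      omega
    simp [h4]

lemma A_finite (n m : ℕ) : (A n m).Finite := (S_finite n m).subset fun _ h => h.1

lemma S_zero (m : ℕ) : (S 0 m).ncard ≤ 1 := by
  rw [Set.ncard_le_one (S_finite 0 m)]
  have : ∀ a ∈ S 0 m, a = 0 := by
    rintro a ⟨h, -⟩
    ext i
    have := le_N a i
    simp; omega
  intro a ha b hb
  rw [this a ha, this b hb]

lemma S_le (n m : ℕ) : (S (n + 1) m).ncard ≤ (A (n + 1) m).ncard + (C (n + 1) m).ncard := by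
  refine le_trans (Set.ncard_le_ncard ?_ ?_) (Set.ncard_union_le _ _)
  · intro a ha
    have h0 : a ≠ 0 := by
      rintro rfl
      have := ha.1
      simp [N] at this
    by_cases h : Even (a (mn a))
    · exact Or.inl ⟨ha, h0, h⟩
    · exact Or.inr ⟨ha, h0, h⟩
  · exact (S_finite (n + 1) m).subset (Set.union_subset (fun _ h => h.1) (fun _ h => h.1))

lemma W_form {a : ℕ →₀ ℕ} (h : ¬ Even (a (mn a))) :
    ∃ t, W a = 2 ^ (mn a + 1) * (2 * t + 1) := by
  have h1 : 2 ^ (mn a + 2) ∣ W (Finsupp.erase (mn a) a) := by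
    apply Finset.dvd_sum
    intro i hi
    have hi' : i ≠ mn a ∧ a i ≠ 0 := by simpa using hi
    have : mn a < i := by
      by_contra hlt
      exact hi'.2 (lt_mn (by omega))
    exact Dvd.dvd.mul_left (pow_dvd_pow 2 (by omega)) _
  obtain ⟨s, hs⟩ := h1
  obtain ⟨u, hu⟩ := Nat.not_even_iff_odd.1 h
  refine ⟨s + u, ?_⟩
  conv_lhs => rw [← Finsupp.single_add_erase (mn a) a]
  rw [W_add, W_single, hs, hu]
  ring

lemma two_adic {j k t s : ℕ} (h : 2 ^ (j + 1) * (2 * t + 1) = 2 ^ (k + 1) * (2 * s + 1)) :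
    ¬ j < k := by
  intro hlt
  obtain ⟨d, rfl⟩ := Nat.exists_eq_add_of_lt hlt
  have : 2 ^ (j + 1) * (2 * t + 1) = 2 ^ (j + 1) * (2 * (2 ^ d * (2 * s + 1))) := by
    rw [h]; ring
  have := Nat.eq_of_mul_eq_mul_left (by positivity) this
  omega

lemma C_mn {n m : ℕ} {a b : ℕ →₀ ℕ} (ha : a ∈ C n m) (hb : b ∈ C n m) : mn a = mn b := by
  obtain ⟨t, ht⟩ := W_form ha.2.2
  obtain ⟨s, hs⟩ := W_form hb.2.2
  rw [ha.1.2] at ht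
  rw [hb.1.2] at hs
  have h1 := two_adic (ht.symm.trans hs)
  have h2 := two_adic (hs.symm.trans ht)
  omega

lemma C_le (n m : ℕ) : ∃ m', (C (n + 1) m).ncard ≤ (S n m').ncard := by
  rcases (C (n + 1) m).eq_empty_or_nonempty with h | ⟨a₀, h₀⟩
  · exact ⟨0, by simp [h]⟩
  · have hle : ∀ a ∈ C (n + 1) m, Finsupp.single (mn a₀) 1 ≤ a := by
      intro a ha
      rw [← C_mn ha h₀]
      have := mn_ne ha.2.1
      rw [Finsupp.single_le_iff]; omega
    refine ⟨m - 2 ^ (mn a₀ + 1), Set.ncard_le_ncard_of_injOn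
      (fun a => a - Finsupp.single (mn a₀) 1) ?_ ?_ (S_finite _ _)⟩
    · intro a ha
      have e := tsub_add_cancel_of_le (hle a ha)
      have h1 := N_add (a - Finsupp.single (mn a₀) 1) (Finsupp.single (mn a₀) 1)
      have h2 := W_add (a - Finsupp.single (mn a₀) 1) (Finsupp.single (mn a₀) 1)
      rw [e, N_single, ha.1.1] at h1
      rw [e, W_single, ha.1.2] at h2
      constructor
      · show N (a - Finsupp.single (mn a₀) 1) = n
        omega
      · show W (a - Finsupp.single (mn a₀) 1) = _
        omega
    · intro a ha b hb hab
      rw [← tsub_add_cancel_of_le (hle a ha), ← tsub_add_cancel_of_le (hle b hb)]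
      exact congrArg (· + Finsupp.single (mn a₀) 1) hab

noncomputable def f (a : ℕ →₀ ℕ) : ℕ →₀ ℕ :=
  (a - Finsupp.single (mn a) 2) + Finsupp.single (mn a + 1) 1

lemma A_two {n m : ℕ} {a : ℕ →₀ ℕ} (ha : a ∈ A n m) : 2 ≤ a (mn a) := by
  have h := mn_ne ha.2.1
  obtain ⟨u, hu⟩ := ha.2.2
  omega

lemma A_back {n m : ℕ} {a : ℕ →₀ ℕ} (ha : a ∈ A n m) :
    (a - Finsupp.single (mn a) 2) + Finsupp.single (mn a) 2 = a :=
  tsub_add_cancel_of_le (by rw [Finsupp.single_le_iff]; exact A_two ha)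

lemma f_mem {n m : ℕ} {a : ℕ →₀ ℕ} (ha : a ∈ A (n + 1) m) : f a ∈ S n m := by
  have e := A_back ha
  have h1 := N_add (a - Finsupp.single (mn a) 2) (Finsupp.single (mn a) 2)
  have h2 := W_add (a - Finsupp.single (mn a) 2) (Finsupp.single (mn a) 2)
  rw [e, N_single, ha.1.1] at h1
  rw [e, W_single, ha.1.2] at h2
  constructor
  · rw [f, N_add, N_single]; omega
  · rw [f, W_add, W_single, h2]; ring

lemma f_inj {n m : ℕ} {a b : ℕ →₀ ℕ} (ha : a ∈ A n m) (hb : b ∈ A n m)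
    (hmn : mn a = mn b) (h : f a = f b) : a = b := by
  rw [← A_back ha, ← A_back hb, ← hmn]
  rw [f, f, ← hmn] at h
  rw [add_right_cancel h]

lemma f_apply (a : ℕ →₀ ℕ) (i : ℕ) :
    f a i = a i - (if mn a = i then 2 else 0) + (if mn a + 1 = i then 1 else 0) := by
  simp [f, Finsupp.single_apply]

lemma f_mn_two {a : ℕ →₀ ℕ} (h : a (mn a) = 2) : mn (f a) = mn a + 1 := by
  apply mn_eq
  · rw [f_apply]; simp
  · intro i hi
    rw [f_apply]
    rcases Nat.lt_succ_iff_lt_or_eq.1 hi with h' | rfl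
    · rw [lt_mn h', if_neg (by omega), if_neg (by omega)]
    · simp [h]

lemma f_mn_four {a : ℕ →₀ ℕ} (h : 2 < a (mn a)) : mn (f a) = mn a := by
  apply mn_eq
  · rw [f_apply]; simp; omega
  · intro i hi
    rw [f_apply, lt_mn hi, if_neg (by omega), if_neg (by omega)]

lemma A_le (n m : ℕ) : (A (n + 1) m).ncard ≤ (A n m).ncard + (S n m).ncard := by
  have hsplit : A (n + 1) m = {a | a ∈ A (n + 1) m ∧ 2 < a (mn a)} ∪
      {a | a ∈ A (n + 1) m ∧ a (mn a) = 2} := by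
    ext a
    constructor
    · intro ha
      rcases (A_two ha).lt_or_eq with h | h
      · exact Or.inl ⟨ha, h⟩
      · exact Or.inr ⟨ha, h.symm⟩
    · rintro (h | h) <;> exact h.1
  rw [hsplit]
  refine le_trans (Set.ncard_union_le _ _) (add_le_add ?_ ?_)
  · refine Set.ncard_le_ncard_of_injOn f ?_ ?_ (A_finite _ _)
    · rintro a ⟨ha, h2⟩
      have hv : f a (mn (f a)) = a (mn a) - 2 := by
        rw [f_mn_four h2, f_apply]; simp
      refine ⟨f_mem ha, ?_, ?_⟩
      · intro h0
        rw [h0] at hv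
        simp at hv; omega
      · rw [hv]
        obtain ⟨u, hu⟩ := ha.2.2
        exact ⟨u - 1, by omega⟩
    · rintro a ⟨ha, h2⟩ b ⟨hb, h3⟩ hab
      refine f_inj ha hb ?_ hab
      rw [← f_mn_four h2, ← f_mn_four h3, hab]
  · refine Set.ncard_le_ncard_of_injOn f ?_ ?_ (S_finite _ _)
    · rintro a ⟨ha, h2⟩
      exact f_mem ha
    · rintro a ⟨ha, h2⟩ b ⟨hb, h3⟩ hab
      refine f_inj ha hb ?_ hab
      have h4 := f_mn_two h2
      have h5 := f_mn_two h3
      rw [hab] at h4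
      omega

lemma main (n : ℕ) : ∀ m, (S (n + 1) m).ncard ≤ Nat.fib (2 * n + 1) ∧
    (A (n + 1) m).ncard ≤ Nat.fib (2 * n) := by
  induction n with
  | zero =>
    intro m
    have hA : A (0 + 1) m = ∅ := by
      rw [Set.eq_empty_iff_forall_notMem]
      intro a ha
      have h1 := A_two ha
      have h2 := le_N a (mn a)
      rw [ha.1.1] at h2
      omega
    have h1 := S_le 0 m
    obtain ⟨m', h2⟩ := C_le 0 m
    have h3 := S_zero m'
    rw [hA] at h1 ⊢
    simp at h1 ⊢
    simp at h2
    omega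
  | succ n ih =>
    intro m
    have h1 := S_le (n + 1) m
    obtain ⟨m', h2⟩ := C_le (n + 1) m
    have h3 := (ih m').1
    have h4 := A_le (n + 1) m
    have h5 := ih m
    have e1 : Nat.fib (2 * (n + 1)) = Nat.fib (2 * n) + Nat.fib (2 * n + 1) := Nat.fib_add_two
    have e2 : Nat.fib (2 * (n + 1) + 1) = Nat.fib (2 * n + 1) + Nat.fib (2 * (n + 1)) :=
      Nat.fib_add_two
    omega

end PTwo

/-- `a i` stands for the variable `a_{i+1}`, so `∑ a_i 2^i` becomes `∑ a i * 2^(i+1)`. -/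
theorem p_two_bound (m n : ℕ) (hm : 1 ≤ m) (hn : 1 ≤ n) :
    Set.ncard {a : ℕ →₀ ℕ |
        a.sum (fun _ c => c) = n ∧ a.sum (fun i c => c * 2 ^ (i + 1)) = m} ≤
      Nat.fib (2 * n - 1) := by
  obtain ⟨k, rfl⟩ := Nat.exists_eq_add_of_le' hn
  exact (PTwo.main k m).1
end

section
/- For every integer q ≥ 4 and all positive integers m and n, the number of representations m = ∑_{i≥0} x_i q^i with x_i nonnegative integers and ∑ x_i ≤ n (i.e., q-ary partitions of m into at most n parts) is at most F(n), where F is the Fibonacci sequence with F(1)=F(2)=1; moreover for q = 2 or 3 the same count is at most F(2n-1). -/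
namespace QAry

/-- The set of `q`-ary partitions of `m` into at most `n` parts. -/
def S (q m n : ℕ) : Set (ℕ →₀ ℕ) :=
  {x : ℕ →₀ ℕ | x.sum (fun i c => c * q ^ i) = m ∧ x.sum (fun _ c => c) ≤ n}

noncomputable def A (q m n : ℕ) : ℕ := (S q m n).ncard

def W (q : ℕ) (x : ℕ →₀ ℕ) : ℕ := x.sum (fun i c => c * q ^ i)
def P (x : ℕ →₀ ℕ) : ℕ := x.sum (fun _ c => c)

lemma mem_S {q m n : ℕ} {x : ℕ →₀ ℕ} : x ∈ S q m n ↔ W q x = m ∧ P x ≤ n := Iff.rfl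

lemma W_add (q : ℕ) (x y : ℕ →₀ ℕ) : W q (x + y) = W q x + W q y := by
  unfold W
  exact Finsupp.sum_add_index' (by simp) (by intros; ring)

lemma P_add (x y : ℕ →₀ ℕ) : P (x + y) = P x + P y := by
  unfold P
  exact Finsupp.sum_add_index' (by simp) (by intros; ring)

lemma W_single (q i c : ℕ) : W q (Finsupp.single i c) = c * q ^ i := by simp [W]
lemma P_single (i c : ℕ) : P (Finsupp.single i c) = c := by simp [P]

/-- Shift of exponents. -/
noncomputable def sh (x : ℕ →₀ ℕ) : ℕ →₀ ℕ := x.mapDomain Nat.succ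

lemma W_sh (q : ℕ) (x : ℕ →₀ ℕ) : W q (sh x) = q * W q x := by
  unfold W sh
  rw [Finsupp.sum_mapDomain_index (by simp) (by intros; ring), Finsupp.mul_sum]
  exact Finsupp.sum_congr (by intros; rw [Nat.succ_eq_add_one]; ring)

lemma P_sh (x : ℕ →₀ ℕ) : P (sh x) = P x := by
  unfold P sh
  rw [Finsupp.sum_mapDomain_index (by simp) (by intros; rfl)]

lemma exists_sh (x : ℕ →₀ ℕ) (h : x 0 = 0) : ∃ y, x = sh y := by
  refine ⟨x.comapDomain Nat.succ (Nat.succ_injective.injOn), ?_⟩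
  unfold sh
  rw [Finsupp.mapDomain_comapDomain _ Nat.succ_injective]
  intro i hi
  cases i with
  | zero => simp [h] at hi
  | succ i => exact ⟨i, rfl⟩

lemma exists_sub (x : ℕ →₀ ℕ) (r : ℕ) (h : r ≤ x 0) : ∃ y, x = y + Finsupp.single 0 r := by
  refine ⟨x - Finsupp.single 0 r, ?_⟩
  rw [tsub_add_cancel_of_le]
  simpa using h

lemma W_mod (q : ℕ) (x : ℕ →₀ ℕ) : ∃ k, W q x = x 0 + q * k := by
  obtain ⟨y, hy⟩ := exists_sub x (x 0) le_rfl
  have h0 : y 0 = 0 := by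
    have := DFunLike.congr_fun hy 0
    simp at this
    exact this
  obtain ⟨z, rfl⟩ := exists_sh y h0
  refine ⟨W q z, ?_⟩
  conv_lhs => rw [hy]
  rw [W_add, W_sh, W_single]
  ring

lemma finite_S {q : ℕ} (hq : 2 ≤ q) (m n : ℕ) : (S q m n).Finite := by
  apply (Set.finite_Iic (∑ i ∈ Finset.range (m+1), Finsupp.single i m)).subset
  intro x hx
  rw [mem_S] at hx
  rw [Set.mem_Iic]
  intro i
  by_cases hi : x i = 0
  · rw [hi]; exact Nat.zero_le _
  have h1 : x i * q ^ i ≤ m := by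
    rw [← hx.1]
    exact Finset.single_le_sum (f := fun i => x i * q ^ i) (fun _ _ => Nat.zero_le _)
      (Finsupp.mem_support_iff.2 hi)
  have h2 : i < q ^ i := Nat.lt_pow_self (by omega)
  have h3 : x i ≤ m := le_trans (Nat.le_mul_of_pos_right _ (by omega)) h1
  have h4 : q ^ i ≤ m := le_trans (Nat.le_mul_of_pos_left _ (by omega)) h1
  rw [Finsupp.finset_sum_apply]
  refine h3.trans ?_
  calc m = (Finsupp.single i m : ℕ →₀ ℕ) i := by simp
    _ ≤ _ := Finset.single_le_sum (f := fun j => (Finsupp.single j m : ℕ →₀ ℕ) i)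
      (fun _ _ => Nat.zero_le _) (Finset.mem_range.2 (by omega))

lemma A_mono {q : ℕ} (hq : 2 ≤ q) (m : ℕ) {n n' : ℕ} (h : n ≤ n') : A q m n ≤ A q m n' :=
  Set.ncard_le_ncard (fun _ hx => ⟨hx.1, hx.2.trans h⟩) (finite_S hq _ _)

lemma eq_zero_of_P {x : ℕ →₀ ℕ} (h : P x = 0) : x = 0 := by
  ext i
  by_contra hi
  have : x i ≤ P x := Finset.single_le_sum (f := fun i => x i) (fun _ _ => Nat.zero_le _)
      (Finsupp.mem_support_iff.2 hi)
  simp at hi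
  omega

lemma P_le_W {q : ℕ} (hq : 2 ≤ q) (x : ℕ →₀ ℕ) : P x ≤ W q x :=
  Finset.sum_le_sum fun i _ => Nat.le_mul_of_pos_right _ (Nat.pow_pos (by omega))

lemma A_zero_left {q : ℕ} (hq : 2 ≤ q) (n : ℕ) : A q 0 n ≤ 1 := by
  unfold A
  rw [← Set.ncard_singleton (0 : ℕ →₀ ℕ)]
  refine Set.ncard_le_ncard (fun x hx => ?_) (Set.finite_singleton _)
  have := P_le_W hq x
  rw [mem_S] at hx
  exact eq_zero_of_P (by omega)

lemma A_eq_zero {q m n : ℕ} (h : ∀ x ∈ S q m n, False) : A q m n = 0 := by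
  unfold A
  rw [Set.eq_empty_iff_forall_notMem.2 h, Set.ncard_empty]

lemma A_zero_right {q m : ℕ} (hm : 1 ≤ m) : A q m 0 = 0 := by
  apply A_eq_zero
  intro x hx
  rw [mem_S] at hx
  have := eq_zero_of_P (Nat.le_zero.1 hx.2)
  subst this
  have h1 := hx.1
  simp [W] at h1
  omega

lemma A_sub {q : ℕ} (hq : 2 ≤ q) (m r n : ℕ) (h : ∀ x, W q x = m + r → r ≤ x 0) :
    A q (m + r) (n + r) ≤ A q m n := by
  refine le_trans (Set.ncard_le_ncard (t := (· + Finsupp.single 0 r) '' S q m n) ?_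
    ((finite_S hq _ _).image _)) (Set.ncard_image_le (finite_S hq _ _))
  intro x hx
  rw [mem_S] at hx
  obtain ⟨y, rfl⟩ := exists_sub x r (h x hx.1)
  rw [W_add, P_add, W_single, P_single] at hx
  exact ⟨y, mem_S.2 ⟨by simp at hx; omega, by omega⟩, rfl⟩

lemma le_P (x : ℕ →₀ ℕ) (i : ℕ) : x i ≤ P x := by
  by_cases hi : x i = 0
  · omega
  · exact Finset.single_le_sum (f := fun i => x i) (fun _ _ => Nat.zero_le _)
      (Finsupp.mem_support_iff.2 hi)

lemma A_sub_zero {q : ℕ} (m r n : ℕ) (h : ∀ x, W q x = m → r ≤ x 0) (hn : n < r) :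
    A q m n = 0 := by
  apply A_eq_zero
  intro x hx
  rw [mem_S] at hx
  have := h x hx.1
  have := le_P x 0
  omega

lemma A_add {q : ℕ} (hq : 2 ≤ q) (m n : ℕ) : A q m n ≤ A q (m + q) (n + 1) := by
  refine Set.ncard_le_ncard_of_injOn (· + Finsupp.single 1 1) ?_ ?_ (finite_S hq _ _)
  · intro x hx
    rw [mem_S] at hx
    refine mem_S.2 ⟨?_, ?_⟩
    · rw [W_add, W_single]; simp [hx.1]
    · rw [P_add, P_single]; omega
  · intro x _ y _ h
    exact add_right_cancel h

lemma x0_cases {q m : ℕ} {x : ℕ →₀ ℕ} (h : W q x = q * m) :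
    x 0 = 0 ∨ q ≤ x 0 := by
  obtain ⟨k, hk⟩ := W_mod q x
  have : q ∣ x 0 := (Nat.dvd_add_left (Dvd.intro k rfl)).1 (by rw [← hk, h]; exact Dvd.intro m rfl)
  rcases Nat.eq_zero_or_pos (x 0) with h0 | h0
  · exact Or.inl h0
  · exact Or.inr (Nat.le_of_dvd h0 this)

lemma sh_mem {q m n : ℕ} (hq : 2 ≤ q) {x : ℕ →₀ ℕ} (hx : x ∈ S q (q * m) n) (h0 : x 0 = 0) :
    x ∈ sh '' S q m n := by
  obtain ⟨y, rfl⟩ := exists_sh x h0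
  rw [mem_S, W_sh, P_sh] at hx
  exact ⟨y, mem_S.2 ⟨Nat.eq_of_mul_eq_mul_left (by omega) hx.1, hx.2⟩, rfl⟩

lemma A_mul_small {q : ℕ} (hq : 2 ≤ q) (m n : ℕ) (hn : n < q) : A q (q * m) n ≤ A q m n := by
  refine le_trans (Set.ncard_le_ncard (t := sh '' S q m n) ?_
    ((finite_S hq _ _).image _)) (Set.ncard_image_le (finite_S hq _ _))
  intro x hx
  rcases x0_cases hx.1 with h | h
  · exact sh_mem hq hx h
  · have := le_P x 0
    have := (mem_S.1 hx).2
    omega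

lemma A_mul {q : ℕ} (hq : 2 ≤ q) (m n : ℕ) :
    A q (q * (m + 1)) (n + q) ≤ A q (m + 1) (n + q) + A q (q * m) n := by
  have h1 := Set.ncard_image_le (f := sh) (finite_S hq (m + 1) (n + q))
  have h2 := Set.ncard_image_le (f := (· + Finsupp.single 0 q)) (finite_S hq (q * m) n)
  refine le_trans (le_trans (Set.ncard_le_ncard ?_
    (((finite_S hq _ _).image _).union ((finite_S hq _ _).image _))) (Set.ncard_union_le _ _))
    (add_le_add h1 h2)
  intro x hx
  rcases x0_cases hx.1 with h | h
  · exact Or.inl (sh_mem hq hx h)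
  · right
    rw [mem_S] at hx
    obtain ⟨y, rfl⟩ := exists_sub x q h
    rw [W_add, P_add, W_single, P_single, mul_add] at hx
    exact ⟨y, mem_S.2 ⟨by simp at hx; omega, by omega⟩, rfl⟩

lemma x0_ge {q M r : ℕ} (hr : r < q) (x : ℕ →₀ ℕ) (h : W q x = q * M + r) : r ≤ x 0 := by
  obtain ⟨k, hk⟩ := W_mod q x
  have : x 0 % q = r := by
    have h1 : (x 0 + q * k) % q = (q * M + r) % q := by rw [← hk, h]
    rwa [Nat.add_mul_mod_self_left, Nat.mul_add_mod, Nat.mod_eq_of_lt hr] at h1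
  rw [← this]
  exact Nat.mod_le _ _

/-- `D q u j n` counts partitions of `q^(j+1) u - q`. -/
noncomputable def D (q u j n : ℕ) : ℕ := A q (q * (q ^ j * u - 1)) n

lemma D_aux {q u : ℕ} (hq : 2 ≤ q) (hu : 1 ≤ u) (j : ℕ) :
    ∃ v, q ^ j * u = v + 1 ∧ q ^ (j + 1) * u = (q * v + (q - 1)) + 1 := by
  obtain ⟨v, hv⟩ : ∃ v, q ^ j * u = v + 1 :=
    Nat.exists_eq_succ_of_ne_zero (by positivity)
  refine ⟨v, hv, ?_⟩
  rw [pow_succ', mul_assoc, hv, mul_add]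
  omega

lemma D_zero {q u : ℕ} (hq : 2 ≤ q) (hu : 1 ≤ u) (j n : ℕ) (hn : n + 1 < q) :
    D q u (j + 1) n = 0 := by
  obtain ⟨v, hv, hv'⟩ := D_aux hq hu j
  have h0 : A q (q * v + (q - 1)) n = 0 :=
    A_sub_zero _ (q - 1) n (fun x hx => x0_ge (by omega) x hx) (by omega)
  have := A_mul_small hq (q * v + (q - 1)) n (by omega)
  unfold D
  rw [hv', Nat.add_sub_cancel]
  omega

lemma D_rec {q u : ℕ} (hq : 2 ≤ q) (hu : 1 ≤ u) (j t : ℕ) :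
    D q u (j + 1) (t + (q - 1)) ≤ D q u j t + D q u (j + 1) t := by
  obtain ⟨v, hv, hv'⟩ := D_aux hq hu j
  have h0 : A q (q * v + (q - 1)) (t + (q - 1)) ≤ A q (q * v) t :=
    A_sub hq _ _ _ (fun x hx => x0_ge (by omega) x hx)
  unfold D
  rw [hv', hv, Nat.add_sub_cancel, Nat.add_sub_cancel]
  cases t with
  | zero =>
    have := A_mul_small hq (q * v + (q - 1)) (0 + (q - 1)) (by omega)
    omega
  | succ t =>
    have h1 := A_mul hq (q * v + (q - 2)) t
    have e1 : q * v + (q - 2) + 1 = q * v + (q - 1) := by omega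
    have e2 : t + q = t + 1 + (q - 1) := by omega
    have h2 := A_add hq (q * (q * v + (q - 2))) t
    have e3 : q * (q * v + (q - 2)) + q = q * (q * v + (q - 1)) := by
      rw [← e1]; ring
    rw [e1, e2] at h1
    rw [e3] at h2
    omega

lemma D_rec' {q u p : ℕ} (hq : 2 ≤ q) (hu : 1 ≤ u) (hp : p ≤ q - 1) (j t : ℕ) :
    D q u (j + 1) (t + p) ≤ D q u j t + D q u (j + 1) t := by
  by_cases h : t + p + 1 < q
  · rw [D_zero hq hu _ _ h]; omega
  · obtain ⟨t', ht'⟩ := Nat.exists_eq_add_of_le' (show q - 1 ≤ t + p by omega)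
    rw [ht']
    refine (D_rec hq hu j t').trans (add_le_add ?_ ?_) <;>
    exact A_mono hq _ (by omega)

section main
variable {q p : ℕ} {G H : ℕ → ℕ}

lemma E_bound (hq : 2 ≤ q) (hp : p ≤ q - 1) (hp1 : 1 ≤ p)
    (hG1 : ∀ n, 1 ≤ n → 1 ≤ G n) (hGH : ∀ n, G n ≤ H n) (hH1 : ∀ n, 1 ≤ H n)
    (hH : ∀ t, G (t + p) + 2 * H t ≤ H (t + p))
    (u : ℕ) (hu : 1 ≤ u) (N : ℕ) (IH : ∀ n, 1 ≤ n → n < N → ∀ m, 1 ≤ m → A q m n ≤ G n) :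
    ∀ n, n < N → ∀ k, ∑ j ∈ Finset.range k, D q u j n ≤ H n := by
  have hD0 : ∀ n, 1 ≤ n → n < N → D q u 0 n ≤ G n := by
    intro n h1 hn
    unfold D
    rcases Nat.eq_zero_or_pos (q * (q ^ 0 * u - 1)) with h | h
    · rw [h]; exact (A_zero_left hq n).trans (hG1 n h1)
    · exact IH n h1 hn _ h
  intro n
  induction n using Nat.strong_induction_on with
  | _ n ih =>
  intro hn k
  cases k with
  | zero => simp
  | succ k =>
  rw [Finset.sum_range_succ']
  by_cases hnp : n < p
  · rw [Finset.sum_eq_zero (fun j _ => D_zero hq hu j n (by omega)), zero_add]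
    rcases Nat.eq_zero_or_pos n with h0 | h0
    · subst h0
      refine le_trans ?_ (hH1 0)
      unfold D
      rcases Nat.eq_zero_or_pos (q * (q ^ 0 * u - 1)) with h | h
      · rw [h]; exact A_zero_left hq 0
      · rw [A_zero_right h]; omega
    · exact (hD0 n h0 hn).trans (hGH n)
  · obtain ⟨t, rfl⟩ := Nat.exists_eq_add_of_le' (show p ≤ n by omega)
    have h1 : ∑ j ∈ Finset.range k, D q u (j + 1) (t + p) ≤
        ∑ j ∈ Finset.range k, D q u j t + ∑ j ∈ Finset.range k, D q u (j + 1) t := by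
      rw [← Finset.sum_add_distrib]
      exact Finset.sum_le_sum fun j _ => D_rec' hq hu hp j t
    have h2 := ih t (by omega) (by omega) k
    have h3 := ih t (by omega) (by omega) (k + 1)
    rw [Finset.sum_range_succ'] at h3
    have h4 := hD0 (t + p) (by omega) hn
    have := hH t
    omega

lemma S_bound (hq : 2 ≤ q) (u : ℕ) (hu : 1 ≤ u) (n k : ℕ) :
    A q (q ^ k * u) (n + q) ≤ A q u (n + q) + ∑ j ∈ Finset.range k, D q u j n := by
  induction k with
  | zero => simp
  | succ k ih =>
    obtain ⟨v, hv, -⟩ := D_aux hq hu k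
    have := A_mul hq v n
    rw [Finset.sum_range_succ]
    have e : D q u k n = A q (q * v) n := by unfold D; rw [hv, Nat.add_sub_cancel]
    rw [e, pow_succ', mul_assoc, hv]
    rw [hv] at ih
    omega

lemma S_small (hq : 2 ≤ q) (u n k : ℕ) (hn : n < q) :
    A q (q ^ k * u) n ≤ A q u n := by
  induction k with
  | zero => simp
  | succ k ih =>
    rw [pow_succ', mul_assoc]
    exact (A_mul_small hq _ n hn).trans ih

theorem main_bound (hq : 2 ≤ q) (hp : p ≤ q - 1) (hp1 : 1 ≤ p)
    (hG1 : ∀ n, 1 ≤ n → 1 ≤ G n) (hGm : Monotone G) (hHm : Monotone H)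
    (hGH : ∀ n, G n ≤ H n) (hH1 : ∀ n, 1 ≤ H n)
    (hH : ∀ t, G (t + p) + 2 * H t ≤ H (t + p))
    (hGG : ∀ t, G (t + p) + H t ≤ G (t + p + 1)) :
    ∀ n, 1 ≤ n → ∀ m, 1 ≤ m → A q m n ≤ G n := by
  intro n
  induction n using Nat.strong_induction_on with
  | _ n IH =>
  intro hn m hm
  obtain ⟨k, u, hqu, rfl⟩ := Nat.exists_eq_pow_mul_and_not_dvd (n := m) (by omega) q (by omega)
  have hu : 1 ≤ u := by
    rcases Nat.eq_zero_or_pos u with h | h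
    · subst h; simp at hqu
    · exact h
  obtain ⟨w, rfl⟩ := Nat.exists_eq_add_of_le' hu
  obtain ⟨n, rfl⟩ := Nat.exists_eq_add_of_le' hn
  have h0 : A q (w + 1) (n + 1) ≤ A q w n := by
    apply A_sub hq
    intro x hx
    obtain ⟨k, hk⟩ := W_mod q x
    by_contra h
    apply hqu
    exact ⟨k, by omega⟩
  have h1 : A q w n ≤ 1 ∧ n = 0 ∨ A q w n ≤ G n ∧ 1 ≤ n := by
    rcases Nat.eq_zero_or_pos w with hw | hw
    · subst hw
      have := A_zero_left hq n
      rcases Nat.eq_zero_or_pos n with h | h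
      · exact Or.inl ⟨this, h⟩
      · exact Or.inr ⟨this.trans (hG1 n h), h⟩
    · rcases Nat.eq_zero_or_pos n with h | h
      · subst h
        rw [A_zero_right hw]; simp
      · exact Or.inr ⟨IH n (by omega) h w hw, h⟩
  by_cases hnq : n + 1 < q
  · refine (S_small hq _ _ k hnq).trans (h0.trans ?_)
    rcases h1 with ⟨h, -⟩ | ⟨h, -⟩
    · exact h.trans (hG1 _ hn)
    · exact h.trans (hGm (by omega))
  · obtain ⟨t, ht⟩ := Nat.exists_eq_add_of_le' (show q ≤ n + 1 by omega)
    obtain ⟨s, hs⟩ := Nat.exists_eq_add_of_le' (show p ≤ n by omega)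
    have h2 := S_bound hq (w + 1) hu t k
    have h3 := E_bound hq hp hp1 hG1 hGH hH1 hH (w + 1) hu (n + 1)
      (fun n' a b => IH n' b a) t (by omega) k
    have h4 : H t ≤ H s := hHm (by omega)
    have h5 := hGG s
    rw [← ht] at h2
    rw [← hs] at h5
    have : A q w n ≤ G n := by
      rcases h1 with ⟨_, h⟩ | ⟨h, -⟩
      · omega
      · exact h
    omega

end main

end QAry

theorem qary_partitions_bounds (q m n : ℕ) (hm : 1 ≤ m) (hn : 1 ≤ n) :
    (4 ≤ q →
      Set.ncard {x : ℕ →₀ ℕ |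
          x.sum (fun i c => c * q ^ i) = m ∧ x.sum (fun _ c => c) ≤ n} ≤ Nat.fib n) ∧
    (q = 2 ∨ q = 3 →
      Set.ncard {x : ℕ →₀ ℕ |
          x.sum (fun i c => c * q ^ i) = m ∧ x.sum (fun _ c => c) ≤ n} ≤
        Nat.fib (2 * n - 1)) := by
  constructor
  · intro hq
    refine QAry.main_bound (q := q) (p := 3) (G := Nat.fib) (H := fun n => Nat.fib (n + 2))
      (by omega) (by omega) (by omega) (fun n h => Nat.fib_pos.2 h) Nat.fib_mono
      (fun a b h => Nat.fib_mono (by omega)) (fun n => Nat.fib_mono (by omega))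
      (fun n => Nat.fib_pos.2 (by omega)) ?_ ?_ n hn m hm
    · intro t
      have h2 := Nat.fib_add_two (n := t + 2)
      have h3 := Nat.fib_add_two (n := t + 3)
      have h4 := Nat.fib_add_two (n := t + 1)
      have h5 : Nat.fib (t + 2) ≤ Nat.fib (t + 3) := Nat.fib_mono (by omega)
      simp only [add_assoc, Nat.reduceAdd] at *
      omega
    · intro t
      have h2 := Nat.fib_add_two (n := t + 2)
      simp only [add_assoc, Nat.reduceAdd] at *
      omega
  · intro hq
    refine QAry.main_bound (q := q) (p := 1) (G := fun n => Nat.fib (2 * n - 1))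
      (H := fun n => Nat.fib (2 * n + 2))
      (by omega) (by omega) (by omega) (fun n h => Nat.fib_pos.2 (by omega))
      (fun a b h => Nat.fib_mono (by omega))
      (fun a b h => Nat.fib_mono (by omega)) (fun n => Nat.fib_mono (by omega))
      (fun n => Nat.fib_pos.2 (by omega)) ?_ ?_ n hn m hm
    · intro t
      have h2 := Nat.fib_add_two (n := 2 * t + 1)
      have h3 := Nat.fib_add_two (n := 2 * t + 2)
      have e1 : 2 * (t + 1) - 1 = 2 * t + 1 := by omega
      have e2 : 2 * (t + 1) + 2 = 2 * t + 4 := by omega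
      simp only [e1, e2]
      simp only [add_assoc, Nat.reduceAdd] at *
      omega
    · intro t
      have h2 := Nat.fib_add_two (n := 2 * t + 1)
      have e1 : 2 * (t + 1) - 1 = 2 * t + 1 := by omega
      have e2 : 2 * (t + 1 + 1) - 1 = 2 * t + 3 := by omega
      simp only [e1, e2]
      simp only [add_assoc, Nat.reduceAdd] at *
      omega
end
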